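/- The true cardinal inequality 𝔟 ≤ 𝔞 is not witnessed by a Borel morphism: there do not exist Borel functions ξ₋ : ℕ^ℕ → [ℕ]^ℕ and ξ₊ : [ℕ]^ℕ → ℕ^ℕ such that for every infinite and co-infinite set A ⊆ ℕ and every f ∈ ℕ^ℕ, if ξ₊(A) ≤* f then A ∩ ξ₋(f) is finite. -/

import Mathlib

open Filter

/-- Eventual domination on `ℕ → ℕ`. -/
def EvLe (α β : ℕ → ℕ) : Prop := ∀ᶠ n in Filter.atTop, α n ≤ β n

/-- `[ℕ]^ℕ`: the space of infinite subsets of `ℕ`, as a subtype of `2^ℕ`. -/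
abbrev InfSubset : Type := {A : ℕ → Bool // {n | A n = true}.Infinite}

open MeasureTheory

/-- Given countably many measurable `ℕ`-valued functions on a probability space, a single sequence
bounds all of them simultaneously on a set of positive measure. -/
lemma exists_measure_forall_le_pos {Ω : Type*} [MeasurableSpace Ω] (μ : Measure Ω)
    [IsProbabilityMeasure μ] (g : ℕ → Ω → ℕ) (hg : ∀ n, Measurable (g n)) :
    ∃ f : ℕ → ℕ, 0 < μ {x | ∀ n, g n x ≤ f n} := by
  obtain ⟨ε, hε, hsum⟩ := ENNReal.exists_pos_sum_of_countable' (ε := 1) one_ne_zero ℕ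
  have hmeas : ∀ n m, MeasurableSet {x | m < g n x} := fun n m =>
    measurableSet_lt measurable_const (hg n)
  have key : ∀ n, ∃ m, μ {x | m < g n x} < ε n := by
    intro n
    have hlim : Tendsto (fun m => μ {x | m < g n x}) atTop
        (nhds (μ (⋂ m, {x | m < g n x}))) := by
      refine tendsto_measure_iInter_atTop (fun m => (hmeas n m).nullMeasurableSet) ?_
        ⟨0, measure_ne_top _ _⟩
      intro a b hab x (hx : b < g n x)
      exact lt_of_le_of_lt hab hx
    have hempty : (⋂ m, {x | m < g n x}) = ∅ := by
      refine Set.eq_empty_of_forall_notMem fun x hx => ?_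
      exact lt_irrefl (g n x) (Set.mem_iInter.mp hx (g n x))
    rw [hempty, measure_empty] at hlim
    exact (hlim.eventually (gt_mem_nhds (hε n))).exists
  choose f hf using key
  refine ⟨f, ?_⟩
  have hcompl : {x | ∀ n, g n x ≤ f n}ᶜ = ⋃ n, {x | f n < g n x} := by
    ext x
    simp
  have hset : MeasurableSet {x | ∀ n, g n x ≤ f n} := by
    rw [← MeasurableSet.compl_iff, hcompl]
    exact MeasurableSet.iUnion fun n => hmeas n _
  have hlt : μ {x | ∀ n, g n x ≤ f n}ᶜ < 1 := by
    rw [hcompl]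
    exact ((measure_iUnion_le _).trans (ENNReal.tsum_le_tsum fun n => (hf n).le)).trans_lt hsum
  refine pos_iff_ne_zero.mpr fun h0 => ?_
  rw [(prob_compl_eq_one_iff hset).mpr h0] at hlt
  exact lt_irrefl _ hlt

/-- The fair coin measure on `2^ℕ`. -/
noncomputable def coinMeasure : Measure (ℕ → Bool) :=
  Measure.infinitePi fun _ => (PMF.uniformOfFintype Bool).toMeasure

instance : IsProbabilityMeasure coinMeasure := by
  unfold coinMeasure
  infer_instance

lemma coinMeasure_forall_mem_eq (s : Finset ℕ) (b : Bool) :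
    coinMeasure {A | ∀ n ∈ s, A n = b} = (2⁻¹ : ENNReal) ^ s.card := by
  have hset : {A : ℕ → Bool | ∀ n ∈ s, A n = b} = Set.pi s fun _ => {b} := by
    ext A
    simp [Set.mem_pi]
  rw [hset, coinMeasure, Measure.infinitePi_pi _ fun _ _ => measurableSet_singleton b]
  simp

/-- Almost every sequence of coin tosses takes each value infinitely often on a given infinite
set. -/
lemma ae_coinMeasure_infinite {B : Set ℕ} (hB : B.Infinite) (b : Bool) :
    ∀ᵐ A ∂coinMeasure, {n | n ∈ B ∧ A n = b}.Infinite := by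
  have hnull : ∀ N : ℕ, coinMeasure {A | ∀ n ∈ B \ Set.Iio N, A n = !b} = 0 := by
    intro N
    have hinf : (B \ Set.Iio N).Infinite := hB.sdiff (Set.finite_Iio N)
    have hlim : Tendsto (fun k : ℕ => (2⁻¹ : ENNReal) ^ k) atTop (nhds 0) :=
      ENNReal.tendsto_pow_atTop_nhds_zero_of_lt_one (by simp)
    refine le_antisymm (ge_of_tendsto' hlim fun k => ?_) zero_le
    obtain ⟨s, hs, rfl⟩ := hinf.exists_subset_card_eq k
    rw [← coinMeasure_forall_mem_eq s (!b)]
    exact measure_mono fun A hA n hn => hA n (hs hn)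
  have hae : ∀ᵐ A ∂coinMeasure, ∀ N : ℕ, ¬ ∀ n ∈ B \ Set.Iio N, A n = !b :=
    ae_all_iff.mpr fun N => by
      rw [ae_iff]
      simpa only [not_not] using hnull N
  filter_upwards [hae] with A hA hfin
  obtain ⟨N, hN⟩ := hfin.bddAbove
  refine hA (N + 1) fun n hn => ?_
  by_contra hne
  have hle : n ≤ N := hN ⟨hn.1, by simpa using hne⟩
  exact hn.2 (Nat.lt_succ_of_le hle)

lemma measurableSet_infinite_true : MeasurableSet {A : ℕ → Bool | {n | A n = true}.Infinite} := by
  have hset : {A : ℕ → Bool | {n | A n = true}.Infinite}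
      = ⋂ N : ℕ, ⋃ n : ℕ, ⋃ _ : N < n, {A | A n = true} := by
    ext A
    simp only [Set.mem_ofPred_eq, Set.mem_iInter, Set.mem_iUnion]
    refine ⟨fun h N => ?_, fun h => Set.infinite_of_forall_exists_gt fun N => ?_⟩
    · obtain ⟨n, hn, hlt⟩ := h.exists_gt N
      exact ⟨n, hlt, hn⟩
    · obtain ⟨n, hlt, hn⟩ := h N
      exact ⟨n, hn, hlt⟩
  rw [hset]
  exact MeasurableSet.iInter fun N => MeasurableSet.iUnion fun n => MeasurableSet.iUnion fun _ =>
    measurableSet_eq_fun (measurable_pi_apply n) measurable_const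

/-- The true inequality `𝔟 ≤ 𝔞` is not witnessed by a Borel morphism: there are
no Borel `ξ₋ : ℕ^ℕ → [ℕ]^ℕ` and `ξ₊ : [ℕ]^ℕ → ℕ^ℕ` such that for every infinite
co-infinite `A ⊆ ℕ` and every `f ∈ ℕ^ℕ`, if `ξ₊(A) ≤* f` then `A ∩ ξ₋(f)` is
finite. -/
theorem no_borel_morphism_b_le_a :
    ¬ ∃ (ξm : (ℕ → ℕ) → InfSubset) (ξp : InfSubset → ℕ → ℕ),
        Measurable ξm ∧ Measurable ξp ∧
        ∀ A : InfSubset, {n | A.1 n = false}.Infinite →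
          ∀ f : ℕ → ℕ, EvLe (ξp A) f →
            {n | A.1 n = true ∧ (ξm f).1 n = true}.Finite := by
  classical
  rintro ⟨ξm, ξp, -, hp, h⟩
  obtain ⟨f, hf⟩ := exists_measure_forall_le_pos coinMeasure
    (fun n A => if hA : {n | A n = true}.Infinite then ξp ⟨A, hA⟩ n else 0)
    (fun n => Measurable.dite (s := {A : ℕ → Bool | {n | A n = true}.Infinite})
      (f := fun A => ξp A n) (g := fun _ => 0)
      ((measurable_pi_apply n).comp hp) measurable_const measurableSet_infinite_true)
  obtain ⟨A, hAf, hAtrue, hAfalse, hAm⟩ := ((frequently_ae_mem_iff.mpr hf.ne').and_eventually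
    ((ae_coinMeasure_infinite Set.infinite_univ true).and
      ((ae_coinMeasure_infinite Set.infinite_univ false).and
        (ae_coinMeasure_infinite (ξm f).2 true)))).exists
  simp only [Set.mem_univ, true_and] at hAtrue hAfalse
  refine hAm ((h ⟨A, hAtrue⟩ hAfalse f (Eventually.of_forall fun n => ?_)).subset
    fun n hn => ⟨hn.2, hn.1⟩)
  simpa [hAtrue] using hAf n
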